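/- arXiv:1411.3120 — 3 statements merged into one kernel-verified Lean document; each statement's English description precedes it below -/
import Mathlib

section
/- Let n ≥ r+1 be such that p_n(c)·p_{n-1}^{[2]}(c)·p_{n-2}^{[4]}(c)·…·p_{n-(r+1)}^{[2(r+1)]}(c) ≠ 0. Then there exist real coefficients λ_{0,n}, λ_{1,n}, …, λ_{r+1,n}, not all zero, such that q_n(x) = Σ_{j=0}^{r+1} λ_{j,n} (x−c)^j p_{n−j}^{[2j]}(x) as an identity of polynomials. -/
open MeasureTheory Polynomial Filter Topology

noncomputable section

/-- The support of a Borel measure on `ℝ`. -/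
def measSupport (μ : Measure ℝ) : Set ℝ := {x | ∀ U ∈ nhds x, μ U ≠ 0}

/-- `P` is a sequence of orthonormal polynomials with respect to the measure `μ`. -/
def IsOPS (μ : Measure ℝ) (P : ℕ → Polynomial ℝ) : Prop :=
  (∀ n, (P n).degree = n) ∧ (∀ n, 0 < (P n).leadingCoeff) ∧
    ∀ n m, (∫ x, (P n).eval x * (P m).eval x ∂μ) = if n = m then 1 else 0

/-- The modified measure `dμ_j(x) = (x-c)^j dμ(x)`. -/
def muMod (μ : Measure ℝ) (c : ℝ) (j : ℕ) : Measure ℝ :=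
  μ.withDensity fun x => ENNReal.ofReal ((x - c) ^ j)

/-- The discrete Sobolev inner product. -/
def sobInner (μ : Measure ℝ) (c : ℝ) (r : ℕ) (M : ℕ → ℝ) (p q : Polynomial ℝ) : ℝ :=
  (∫ x, p.eval x * q.eval x ∂μ) +
    ∑ i ∈ Finset.range (r + 1),
      M i * (Polynomial.derivative^[i] p).eval c * (Polynomial.derivative^[i] q).eval c

/-- `Q` is the sequence of orthonormal polynomials for the Sobolev inner product. -/
def IsSobOPS (μ : Measure ℝ) (c : ℝ) (r : ℕ) (M : ℕ → ℝ) (Q : ℕ → Polynomial ℝ) : Prop :=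
  (∀ n, (Q n).degree = n) ∧ (∀ n, 0 < (Q n).leadingCoeff) ∧
    ∀ n m, sobInner μ c r M (Q n) (Q m) = if n = m then 1 else 0

/-- Every polynomial of degree less than `n` is in the span of the first `n` terms of a sequence of
polynomials whose `k`-th term has degree `k`. -/
theorem mem_span_of_degree_lt {P : ℕ → Polynomial ℝ} (hP : ∀ k, (P k).degree = k) :
    ∀ (n : ℕ) (g : Polynomial ℝ), g.degree < n → g ∈ Submodule.span ℝ (P '' Set.Iio n) := by
  intro n
  induction n with
  | zero =>
    intro g hg
    have : g = 0 := by simpa using hg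
    simp [this]
  | succ n ih =>
    intro g hg
    have hcoeff : (P n).coeff n ≠ 0 := coeff_ne_zero_of_eq_degree (hP n)
    set a := g.coeff n / (P n).coeff n with ha
    have hlt : (g - a • P n).degree < n := by
      rw [degree_lt_iff_coeff_zero]
      intro m hm
      rcases hm.eq_or_lt with rfl | hm
      · simp [ha, hcoeff]
      · rw [coeff_sub, coeff_smul, (degree_lt_iff_coeff_zero g (n + 1)).1 hg m hm,
          coeff_eq_zero_of_degree_lt (by rw [hP]; exact_mod_cast hm)]
        simp
    have hmono : Submodule.span ℝ (P '' Set.Iio n) ≤ Submodule.span ℝ (P '' Set.Iio (n + 1)) :=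
      Submodule.span_mono (Set.image_mono (Set.Iio_subset_Iio n.le_succ))
    rw [← sub_add_cancel g (a • P n)]
    exact add_mem (hmono (ih _ hlt))
      (Submodule.smul_mem _ _ (Submodule.subset_span ⟨n, Nat.lt_succ_self n, rfl⟩))

theorem orthonormal_apply_eq_zero_of_degree_lt {P : ℕ → Polynomial ℝ}
    (hP : ∀ k, (P k).degree = k) {B : Polynomial ℝ →ₗ[ℝ] Polynomial ℝ →ₗ[ℝ] ℝ}
    (hB : ∀ k m, B (P k) (P m) = if k = m then 1 else 0) {n : ℕ} {g : Polynomial ℝ}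
    (hg : g.degree < n) : B (P n) g = 0 := by
  have hle : Submodule.span ℝ (P '' Set.Iio n) ≤ LinearMap.ker (B (P n)) := by
    rw [Submodule.span_le]
    rintro _ ⟨k, hk, rfl⟩
    simp [hB, (Set.mem_Iio.1 hk).ne']
  exact hle (mem_span_of_degree_lt hP n g hg)

/-- Up to a scalar, `P n` is the only polynomial of degree at most `n` that is orthogonal to all
polynomials of lower degree. -/
theorem eq_C_mul_of_orthogonal {P : ℕ → Polynomial ℝ}
    (hP : ∀ k, (P k).degree = k) {B : Polynomial ℝ →ₗ[ℝ] Polynomial ℝ →ₗ[ℝ] ℝ}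
    (hB : ∀ k m, B (P k) (P m) = if k = m then 1 else 0) {n : ℕ} {h : Polynomial ℝ}
    (hdeg : h.degree < (n + 1 : ℕ)) (horth : ∀ g : Polynomial ℝ, g.degree < n → B h g = 0) :
    ∃ a : ℝ, h = C a * P n := by
  have hmem := mem_span_of_degree_lt hP (n + 1) h hdeg
  rw [Finsupp.mem_span_image_iff_linearCombination] at hmem
  obtain ⟨l, hl, rfl⟩ := hmem
  have hcoef (m : ℕ) : B (Finsupp.linearCombination ℝ P l) (P m) = l m := by
    rw [Finsupp.linearCombination_apply, Finsupp.sum, map_sum, LinearMap.sum_apply]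
    simp +contextual [hB]
  refine ⟨l n, ?_⟩
  have hsingle : l = Finsupp.single n (l n) := by
    ext k
    rcases lt_trichotomy k n with hk | rfl | hk
    · rw [← hcoef k, horth _ (by rw [hP]; exact_mod_cast hk), Finsupp.single_eq_of_ne hk.ne]
    · simp
    · rw [Finsupp.single_eq_of_ne hk.ne']
      by_contra hne
      have := (Finsupp.mem_supported ℝ l).1 hl (Finsupp.mem_support_iff.2 hne)
      exact absurd (Set.mem_Iio.1 this) (by omega)
  rw [← smul_eq_C_mul, hsingle, Finsupp.linearCombination_single, Finsupp.single_eq_same]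

/-- Triangular elimination of the first `m` Taylor coefficients at `c`. -/
theorem exists_X_sub_C_pow_dvd_sub (c : ℝ) (m : ℕ) : ∀ (T : ℕ → Polynomial ℝ) (f : Polynomial ℝ),
    (∀ j < m, (T j).eval c ≠ 0) → ∃ lam : ℕ → ℝ,
      (X - C c) ^ m ∣ f - ∑ j ∈ Finset.range m, C (lam j) * (X - C c) ^ j * T j := by
  induction m with
  | zero => intro T f _; exact ⟨0, by simp⟩
  | succ m ih =>
    intro T f hT
    set a := f.eval c / (T 0).eval c with ha
    have h0 := hT 0 m.succ_pos
    have hroot : (f - C a * T 0).IsRoot c := by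
      simp [ha, h0]
    obtain ⟨f₁, hf₁⟩ := dvd_iff_isRoot.2 hroot
    obtain ⟨lam, g, hg⟩ := ih (fun j => T (j + 1)) f₁ fun j hj => hT (j + 1) (by omega)
    refine ⟨fun j => Nat.casesOn j a lam, g, ?_⟩
    rw [Finset.sum_range_succ']
    have hsum : ∑ j ∈ Finset.range m, C (lam j) * (X - C c) ^ (j + 1) * T (j + 1) =
        (X - C c) * ∑ j ∈ Finset.range m, C (lam j) * (X - C c) ^ j * T (j + 1) := by
      rw [Finset.mul_sum]
      exact Finset.sum_congr rfl fun j _ => by ring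
    simp only [hsum]
    linear_combination hf₁ + (X - C c) * hg

/-- Integration of polynomials against `μ`. -/
def polyIntegral (μ : Measure ℝ)
    (hint : ∀ p : Polynomial ℝ, Integrable (fun x => p.eval x) μ) : Polynomial ℝ →ₗ[ℝ] ℝ where
  toFun p := ∫ x, p.eval x ∂μ
  map_add' p q := by simp only [eval_add]; exact integral_add (hint p) (hint q)
  map_smul' a p := by simp only [eval_smul, smul_eq_mul, integral_const_mul, RingHom.id_apply]

/-- The bilinear form `(p, q) ↦ ∫ w p q dμ` with polynomial weight `w`. -/
def weightedForm (μ : Measure ℝ)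
    (hint : ∀ p : Polynomial ℝ, Integrable (fun x => p.eval x) μ) (w : Polynomial ℝ) :
    Polynomial ℝ →ₗ[ℝ] Polynomial ℝ →ₗ[ℝ] ℝ :=
  (LinearMap.mul ℝ (Polynomial ℝ)).compr₂ (polyIntegral μ hint ∘ₗ LinearMap.mulLeft ℝ w)

theorem weightedForm_apply (μ : Measure ℝ)
    (hint : ∀ p : Polynomial ℝ, Integrable (fun x => p.eval x) μ) (w p q : Polynomial ℝ) :
    weightedForm μ hint w p q = polyIntegral μ hint (w * (p * q)) := rfl

theorem weightedForm_eq_integral_muMod (μ : Measure ℝ)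
    (hint : ∀ p : Polynomial ℝ, Integrable (fun x => p.eval x) μ) (c : ℝ) (j : ℕ)
    (p q : Polynomial ℝ) :
    weightedForm μ hint ((X - C c) ^ (2 * j)) p q =
      ∫ x, p.eval x * q.eval x ∂(muMod μ c (2 * j)) := by
  rw [muMod, integral_withDensity_eq_integral_toReal_smul (by fun_prop) (by simp)]
  change ∫ x, _ ∂μ = _
  congr 1
  ext x
  rw [ENNReal.toReal_ofReal ((even_two_mul j).pow_nonneg _)]
  simp

/-- `sobInner` as a bilinear map. -/
def sobForm (μ : Measure ℝ)
    (hint : ∀ p : Polynomial ℝ, Integrable (fun x => p.eval x) μ) (c : ℝ) (r : ℕ) (M : ℕ → ℝ) :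
    Polynomial ℝ →ₗ[ℝ] Polynomial ℝ →ₗ[ℝ] ℝ :=
  weightedForm μ hint 1 + ∑ i ∈ Finset.range (r + 1),
    M i • (LinearMap.mul ℝ ℝ).compl₁₂ (leval c ∘ₗ derivative ^ i) (leval c ∘ₗ derivative ^ i)

theorem sobForm_apply (μ : Measure ℝ)
    (hint : ∀ p : Polynomial ℝ, Integrable (fun x => p.eval x) μ) (c : ℝ) (r : ℕ) (M : ℕ → ℝ)
    (p q : Polynomial ℝ) : sobForm μ hint c r M p q = sobInner μ c r M p q := by
  simp [sobForm, sobInner, weightedForm_apply, polyIntegral, LinearMap.sum_apply,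
    Module.End.pow_apply, mul_assoc]

/-- The discrete part of the Sobolev product does not see multiples of `(X - c) ^ (r + 1)`. -/
theorem sobForm_X_sub_C_pow_mul (μ : Measure ℝ)
    (hint : ∀ p : Polynomial ℝ, Integrable (fun x => p.eval x) μ) (c : ℝ) (r : ℕ) (M : ℕ → ℝ)
    (p g : Polynomial ℝ) :
    sobForm μ hint c r M p ((X - C c) ^ (r + 1) * g) =
      polyIntegral μ hint (p * ((X - C c) ^ (r + 1) * g)) := by
  have hzero : ∀ i ∈ Finset.range (r + 1),
      M i * (derivative^[i] p).eval c *
        (derivative^[i] ((X - C c) ^ (r + 1) * g)).eval c = 0 := by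
    intro i hi
    have hi' : r + 1 - i ≠ 0 := by have := Finset.mem_range.1 hi; omega
    have hdvd : X - C c ∣ derivative^[i] ((X - C c) ^ (r + 1) * g) :=
      (dvd_pow_self _ hi').trans
        (pow_sub_dvd_iterate_derivative_of_pow_dvd i (dvd_mul_right _ _))
    rw [(dvd_iff_isRoot.1 hdvd).eq_zero, mul_zero]
  rw [sobForm_apply, sobInner, Finset.sum_eq_zero hzero, add_zero]
  simp [polyIntegral]

/-- **Theorem 1 (connection formula).**  If `n ≥ r+1` and
`p_n(c)·p_{n-1}^{[2]}(c)·…·p_{n-(r+1)}^{[2(r+1)]}(c) ≠ 0`, then there are real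
coefficients `λ_{0,n}, …, λ_{r+1,n}`, not all zero, with
`q_n(x) = Σ_{j=0}^{r+1} λ_{j,n} (x-c)^j p_{n-j}^{[2j]}(x)`. -/
theorem connection_formula
    (μ : Measure ℝ) [IsFiniteMeasure μ]
    (hsupp : (measSupport μ).Infinite)
    (hint : ∀ p : Polynomial ℝ, Integrable (fun x => p.eval x) μ)
    (c : ℝ) (r : ℕ) (M : ℕ → ℝ) (hM : ∀ i ≤ r, 0 ≤ M i)
    (P : ℕ → ℕ → Polynomial ℝ)
    (hP : ∀ j ≤ r + 1, IsOPS (muMod μ c (2 * j)) (P j))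
    (q : ℕ → Polynomial ℝ) (hq : IsSobOPS μ c r M q)
    (n : ℕ) (hn : r + 1 ≤ n)
    (hnz : (∏ j ∈ Finset.range (r + 2), (P j (n - j)).eval c) ≠ 0) :
    ∃ lam : ℕ → ℝ, (∃ j ≤ r + 1, lam j ≠ 0) ∧
      q n = ∑ j ∈ Finset.range (r + 2),
        Polynomial.C (lam j) * (Polynomial.X - Polynomial.C c) ^ j * P j (n - j) := by
  have hPdeg (j : ℕ) (hj : j ≤ r + 1) (k : ℕ) : (P j k).degree = k := (hP j hj).1 k
  have hPorth (j : ℕ) (hj : j ≤ r + 1) (k m : ℕ) :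
      weightedForm μ hint ((X - C c) ^ (2 * j)) (P j k) (P j m) = if k = m then 1 else 0 := by
    rw [weightedForm_eq_integral_muMod, (hP j hj).2.2]
  have hqorth (k m : ℕ) : sobForm μ hint c r M (q k) (q m) = if k = m then 1 else 0 := by
    rw [sobForm_apply, hq.2.2]
  have hpow (k : ℕ) : ((X - C c) ^ k : Polynomial ℝ).degree = k := by
    rw [degree_pow, degree_X_sub_C, nsmul_one]
  have hlow (k l : ℕ) (g : Polynomial ℝ) (hg : g.degree < l) :
      ((X - C c) ^ k * g).degree < ((k + l : ℕ) : WithBot ℕ) := by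
    rw [degree_mul, hpow, Nat.cast_add]
    exact WithBot.add_lt_add_left (WithBot.natCast_ne_bot k) hg
  obtain ⟨lam, h, hh⟩ := exists_X_sub_C_pow_dvd_sub c (r + 1) (fun j => P j (n - j)) (q n)
    fun j hj => Finset.prod_ne_zero_iff.1 hnz j (Finset.mem_range.2 (by omega))
  have horth (g : Polynomial ℝ) (hg : g.degree < (n - (r + 1) : ℕ)) :
      weightedForm μ hint ((X - C c) ^ (2 * (r + 1))) h g = 0 := by
    have hmul : (X - C c) ^ (2 * (r + 1)) * (h * g) =
        q n * ((X - C c) ^ (r + 1) * g) - ∑ j ∈ Finset.range (r + 1),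
          lam j • ((X - C c) ^ j * P j (n - j) * ((X - C c) ^ (r + 1) * g)) := by
      simp only [smul_eq_C_mul, ← mul_assoc (C _)]
      rw [← Finset.sum_mul, ← sub_mul, hh]
      ring
    rw [weightedForm_apply, hmul, map_sub, map_sum, ← sobForm_X_sub_C_pow_mul (r := r) (M := M),
      orthonormal_apply_eq_zero_of_degree_lt hq.1 hqorth
        ((hlow (r + 1) _ g hg).trans_eq (by rw [Nat.add_sub_cancel' hn])), zero_sub, neg_eq_zero]
    refine Finset.sum_eq_zero fun j hj => ?_
    have hj' : j < r + 1 := Finset.mem_range.1 hj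
    have hsplit : (X - C c) ^ j * P j (n - j) * ((X - C c) ^ (r + 1) * g) =
        (X - C c) ^ (2 * j) * (P j (n - j) * ((X - C c) ^ (r + 1 - j) * g)) := by
      obtain ⟨d, hd⟩ := Nat.exists_eq_add_of_le hj'.le
      rw [hd, Nat.add_sub_cancel_left]
      ring
    rw [map_smul, hsplit, ← weightedForm_apply,
      orthonormal_apply_eq_zero_of_degree_lt (hPdeg j hj'.le) (hPorth j hj'.le)
        ((hlow (r + 1 - j) _ g hg).trans_eq (by congr 1; omega)), smul_zero]
  have hdeg : h.degree < ((n - (r + 1) + 1 : ℕ) : WithBot ℕ) := by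
    have hle : ((X - C c) ^ (r + 1) * h).degree ≤ (n : WithBot ℕ) := by
      rw [← hh]
      refine (degree_sub_le _ _).trans (max_le (hq.1 n).le ?_)
      refine (degree_sum_le _ _).trans (Finset.sup_le fun j hj => ?_)
      have hj' : j < r + 1 := Finset.mem_range.1 hj
      rw [degree_mul, degree_mul, hpow, hPdeg j hj'.le, add_assoc, ← Nat.cast_add,
        Nat.add_sub_cancel' (by omega : j ≤ n)]
      simpa using add_le_add_left (degree_C_le (a := lam j)) (n : WithBot ℕ)
    by_contra! hge
    rw [degree_mul, hpow] at hle
    have := (add_le_add_right hge ((r + 1 : ℕ) : WithBot ℕ)).trans hle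
    rw [← Nat.cast_add, Nat.cast_le] at this
    omega
  obtain ⟨a, ha⟩ := eq_C_mul_of_orthogonal (hPdeg _ le_rfl) (hPorth _ le_rfl) hdeg horth
  have hsum : q n = ∑ j ∈ Finset.range (r + 2),
      C (Function.update lam (r + 1) a j) * (X - C c) ^ j * P j (n - j) := by
    rw [Finset.sum_range_succ, Function.update_self, Finset.sum_congr rfl fun j hj => by
      rw [Function.update_of_ne (Finset.mem_range.1 hj).ne]]
    rw [ha] at hh
    linear_combination hh
  refine ⟨_, ?_, hsum⟩
  by_contra! hall
  have hzero : q n = 0 := by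
    rw [hsum]
    refine Finset.sum_eq_zero fun j hj => ?_
    rw [hall j (by have := Finset.mem_range.1 hj; omega)]
    simp
  have := hq.1 n
  simp [hzero] at this
end
end

section
/- Suppose there is a strictly increasing function f: ℕ → ℝ with 2f(0)+1 > 0 such that for every integer k ≥ 0 there exists a nonzero constant C_k with lim_{n→∞} p_n^{(k)}(c) / ((−1)^n n^{f(k)}) = C_k. Then: (i) for every k with 0 ≤ k ≤ r and M_k > 0 there exists a nonzero constant D_k with lim_{n→∞} n^{2f(k)+1} · q_n^{(k)}(c)/p_n^{(k)}(c) = D_k; (ii) for every other k ≥ 0 there exists a nonzero constant D_k with lim_{n→∞} q_n^{(k)}(c)/p_n^{(k)}(c) = D_k. -/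
open MeasureTheory Polynomial Filter Topology

noncomputable section

section CauchySystem

variable {ι : Type*} [Fintype ι] [DecidableEq ι] {g v : ι → ℝ} {e : ℝ}

/-- If the partial fraction `e - ∑ i, v i / (s + g i + 1)` vanishes at every `s = g k`, then its
numerator is `e` times the product of the `s - g k`. -/
theorem cauchy_numerator_eq (hg : Function.Injective g) (hpos : ∀ i, 0 < 2 * g i + 1)
    (hv : ∀ k, ∑ i, v i / (g k + g i + 1) = e) :
    C e * Lagrange.nodal Finset.univ (fun i => -(g i + 1)) -
      ∑ i, C (v i) * Lagrange.nodal (Finset.univ.erase i) (fun i => -(g i + 1)) =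
    C e * Lagrange.nodal Finset.univ g := by
  have hne : ∀ i k, g k + g i + 1 ≠ 0 := fun i k => by linarith [hpos i, hpos k]
  refine eq_of_degree_sub_lt_of_eval_index_eq Finset.univ hg.injOn ?_ ?_
  · rw [sub_right_comm, ← mul_sub, ← mem_degreeLT]
    refine Submodule.sub_mem _ ?_ (Submodule.sum_mem _ fun i _ => ?_)
    · rw [← smul_eq_C_mul]
      refine Submodule.smul_mem _ _ (mem_degreeLT.2 ?_)
      rw [← Lagrange.degree_nodal (s := Finset.univ) (v := fun i => -(g i + 1))]
      exact degree_sub_lt_left (by simp only [Lagrange.degree_nodal]) Lagrange.nodal_ne_zero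
        (Lagrange.nodal_monic.leadingCoeff.trans Lagrange.nodal_monic.leadingCoeff.symm)
    · rw [← smul_eq_C_mul]
      refine Submodule.smul_mem _ _ (mem_degreeLT.2 ?_)
      rw [Lagrange.degree_nodal]
      exact_mod_cast Finset.card_erase_lt_of_mem (Finset.mem_univ i)
  · intro k _
    have key : ∀ i, v i * ∏ j ∈ Finset.univ.erase i, (g k - -(g j + 1)) =
        v i / (g k + g i + 1) * ∏ j, (g k - -(g j + 1)) := by
      intro i
      rw [← Finset.mul_prod_erase _ _ (Finset.mem_univ i), ← mul_assoc]
      congr 1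
      have := hne i k
      field_simp
      ring
    simp only [eval_sub, eval_mul, eval_C, eval_finsetSum, Lagrange.eval_nodal, key,
      ← Finset.sum_mul, hv, sub_self]
    rw [Finset.prod_eq_zero (Finset.mem_univ k) (sub_self _), mul_zero]

theorem cauchy_residue_eq (hg : Function.Injective g) (hpos : ∀ i, 0 < 2 * g i + 1)
    (hv : ∀ k, ∑ i, v i / (g k + g i + 1) = e) (i : ι) :
    v i * ∏ j ∈ Finset.univ.erase i, (g j - g i) = -e * ∏ k, (-(g i + 1) - g k) := by
  have h := congrArg (eval (-(g i + 1))) (cauchy_numerator_eq hg hpos hv)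
  simp only [eval_sub, eval_mul, eval_C, eval_finsetSum, Lagrange.eval_nodal] at h
  rw [Finset.prod_eq_zero (Finset.mem_univ i) (sub_self _),
    Finset.sum_eq_single i (fun b _ hb => ?_) (by simp)] at h
  · have h2 : ∏ j ∈ Finset.univ.erase i, (g j - g i) =
        ∏ j ∈ Finset.univ.erase i, (-(g i + 1) - -(g j + 1)) :=
      Finset.prod_congr rfl fun j _ => by ring
    rw [h2]
    linarith
  · rw [Finset.prod_eq_zero (Finset.mem_erase.2 ⟨hb.symm, Finset.mem_univ i⟩) (sub_self _),
      mul_zero]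

/-- The Cauchy matrix `1 / (g k + g i + 1)` is nonsingular. -/
theorem cauchy_det_ne_zero (hg : Function.Injective g) (hpos : ∀ i, 0 < 2 * g i + 1) :
    (Matrix.of fun k i => 1 / (g k + g i + 1)).det ≠ 0 := by
  intro h
  obtain ⟨v, hv0, hv⟩ := Matrix.exists_mulVec_eq_zero_iff.2 h
  refine hv0 (funext fun i => ?_)
  have hsum : ∀ k, ∑ i, v i / (g k + g i + 1) = 0 := fun k => by
    simpa [Matrix.mulVec, dotProduct, div_eq_inv_mul] using congrFun hv k
  have := cauchy_residue_eq hg hpos hsum i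
  rw [neg_zero, zero_mul, mul_eq_zero, Finset.prod_eq_zero_iff] at this
  refine this.resolve_right ?_
  rintro ⟨j, hj, hji⟩
  exact (Finset.mem_erase.1 hj).1 (hg (sub_eq_zero.1 hji))

theorem cauchy_solution_ne_zero (hg : Function.Injective g) (hpos : ∀ i, 0 < 2 * g i + 1)
    (hv : ∀ k, ∑ i, v i / (g k + g i + 1) = 1) (i : ι) : v i ≠ 0 := by
  intro h
  have := cauchy_residue_eq hg hpos hv i
  rw [h, zero_mul, eq_comm, neg_one_mul, neg_eq_zero, Finset.prod_eq_zero_iff] at this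
  obtain ⟨k, _, hk⟩ := this
  linarith [hpos i, hpos k]

theorem cauchy_partialFraction_ne_zero (hg : Function.Injective g)
    (hpos : ∀ i, 0 < 2 * g i + 1) (hv : ∀ k, ∑ i, v i / (g k + g i + 1) = 1) {s : ℝ}
    (hs : 0 < 2 * s + 1) (hsg : ∀ i, s ≠ g i) : 1 - ∑ i, v i / (s + g i + 1) ≠ 0 := by
  intro h0
  have h := congrArg (eval s) (cauchy_numerator_eq hg hpos hv)
  have key : ∀ i, v i * ∏ j ∈ Finset.univ.erase i, (s - -(g j + 1)) =
      v i / (s + g i + 1) * ∏ j, (s - -(g j + 1)) := by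
    intro i
    rw [← Finset.mul_prod_erase _ _ (Finset.mem_univ i), ← mul_assoc]
    congr 1
    have : s + g i + 1 ≠ 0 := by linarith [hpos i]
    field_simp
    ring
  simp only [eval_sub, eval_mul, eval_C, eval_finsetSum, Lagrange.eval_nodal, key,
    ← Finset.sum_mul, one_mul] at h
  rw [← one_sub_mul, h0, zero_mul] at h
  obtain ⟨k, _, hk⟩ := Finset.prod_eq_zero_iff.1 h.symm
  exact hsg k (sub_eq_zero.1 hk)

end CauchySystem

theorem tendsto_mulVec {ι : Type*} [Fintype ι] {A : ℕ → Matrix ι ι ℝ} {B : Matrix ι ι ℝ}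
    {x : ℕ → ι → ℝ} {z : ι → ℝ} (hA : Tendsto A atTop (𝓝 B)) (hx : Tendsto x atTop (𝓝 z)) :
    Tendsto (fun n => (A n).mulVec (x n)) atTop (𝓝 (B.mulVec z)) :=
  tendsto_pi_nhds.2 fun i => tendsto_finsetSum _ fun j _ =>
    (tendsto_pi_nhds.1 (tendsto_pi_nhds.1 hA i) j).mul (tendsto_pi_nhds.1 hx j)

/-- Solutions of convergent linear systems with nonsingular limit matrix converge. -/
theorem tendsto_of_mulVec_tendsto {ι : Type*} [Fintype ι] [DecidableEq ι]
    {A : ℕ → Matrix ι ι ℝ} {B : Matrix ι ι ℝ} {x y : ℕ → ι → ℝ} {z : ι → ℝ}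
    (hA : Tendsto A atTop (𝓝 B)) (hB : B.det ≠ 0) (hy : Tendsto y atTop (𝓝 z))
    (h : ∀ᶠ n in atTop, (A n).mulVec (x n) = y n) :
    Tendsto x atTop (𝓝 (B⁻¹.mulVec z)) := by
  have hdet : Tendsto (fun n => (A n).det) atTop (𝓝 B.det) :=
    (Continuous.tendsto (Continuous.matrix_det continuous_id) B).comp hA
  have hadj : Tendsto (fun n => (A n).adjugate) atTop (𝓝 B.adjugate) :=
    (Continuous.tendsto (Continuous.matrix_adjugate continuous_id) B).comp hA
  have hmv : Tendsto (fun n => (A n).adjugate.mulVec (y n)) atTop (𝓝 (B.adjugate.mulVec z)) :=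
    tendsto_mulVec hadj hy
  have hlim := (hdet.inv₀ hB).smul hmv
  rw [Matrix.inv_def, Ring.inverse_eq_inv', Matrix.smul_mulVec]
  refine hlim.congr' ?_
  filter_upwards [h, hdet.eventually_ne hB] with n hn hn0
  rw [← hn, Matrix.mulVec_mulVec, Matrix.adjugate_mul, Matrix.smul_mulVec, Matrix.one_mulVec,
    smul_smul, inv_mul_cancel₀ hn0, one_smul]

theorem tendsto_succ_rpow_sub_rpow_div {s : ℝ} :
    Tendsto (fun n : ℕ => (((n + 1 : ℕ) : ℝ) ^ (s + 1) - (n : ℝ) ^ (s + 1)) / (n : ℝ) ^ s)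
      atTop (𝓝 (s + 1)) := by
  have hd : HasDerivAt (fun x : ℝ => x ^ (s + 1)) (s + 1) 1 := by
    simpa using Real.hasDerivAt_rpow_const (x := 1) (p := s + 1) (Or.inl one_ne_zero)
  have h := hd.tendsto_slope_zero_right.comp
    (tendsto_inv_atTop_nhdsGT_zero.comp (tendsto_natCast_atTop_atTop (R := ℝ)))
  refine h.congr' ?_
  filter_upwards [eventually_gt_atTop 0] with n hn
  have hn' : (0 : ℝ) < n := by exact_mod_cast hn
  have h1 : (((n + 1 : ℕ) : ℝ)) = n * (1 + (n : ℝ)⁻¹) := by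
    push_cast
    field_simp
  rw [h1, Real.mul_rpow hn'.le (by positivity), Real.rpow_add_one hn'.ne']
  have := (Real.rpow_pos_of_pos hn' s).ne'
  simp only [Function.comp, inv_inv, smul_eq_mul, Real.one_rpow]
  field_simp

/-- Partial sums of a sequence asymptotic to `L * n ^ s`, `s > -1`. -/
theorem tendsto_sum_range_div_rpow {u : ℕ → ℝ} {L s : ℝ} (hs : 0 < s + 1)
    (hu : Tendsto (fun n => u n / (n : ℝ) ^ s) atTop (𝓝 L)) :
    Tendsto (fun n => (∑ j ∈ Finset.range n, u j) / (n : ℝ) ^ (s + 1)) atTop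
      (𝓝 (L / (s + 1))) := by
  set w : ℕ → ℝ := fun n => ((n + 1 : ℕ) : ℝ) ^ (s + 1) - (n : ℝ) ^ (s + 1) with hw
  have hwsum : ∀ n, ∑ j ∈ Finset.range n, w j = (n : ℝ) ^ (s + 1) := fun n => by
    rw [Finset.sum_range_sub (fun n : ℕ => (n : ℝ) ^ (s + 1))]
    simp [Real.zero_rpow hs.ne']
  have hwpos : ∀ n, 0 < w n := fun n =>
    sub_pos.2 (Real.rpow_lt_rpow n.cast_nonneg (by push_cast; linarith) hs)
  have hratio : Tendsto (fun n => u n / w n) atTop (𝓝 (L / (s + 1))) := by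
    refine (hu.div tendsto_succ_rpow_sub_rpow_div hs.ne').congr' ?_
    filter_upwards [eventually_gt_atTop 0] with n hn
    exact div_div_div_cancel_right₀ (Real.rpow_pos_of_pos (by exact_mod_cast hn) s).ne' _ _
  have hlittle : (fun n => u n - L / (s + 1) * w n) =o[atTop] w := by
    rw [Asymptotics.isLittleO_iff_tendsto fun n hn => absurd hn (hwpos n).ne']
    refine (sub_self (L / (s + 1)) ▸ hratio.sub_const (L / (s + 1))).congr fun n => ?_
    rw [sub_div, mul_div_cancel_right₀ _ (hwpos n).ne']
  have htop : Tendsto (fun n => ∑ j ∈ Finset.range n, w j) atTop atTop := by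
    simp only [hwsum]
    exact (tendsto_rpow_atTop hs).comp tendsto_natCast_atTop_atTop
  have hsum := (hlittle.sum_range (fun n => (hwpos n).le) htop).tendsto_div_nhds_zero
  simp only [Finset.sum_sub_distrib, ← Finset.mul_sum, hwsum] at hsum
  refine (zero_add (L / (s + 1)) ▸ hsum.add_const (L / (s + 1))).congr' ?_
  filter_upwards [eventually_gt_atTop 0] with n hn
  have := (Real.rpow_pos_of_pos (Nat.cast_pos.2 hn : (0 : ℝ) < n) (s + 1)).ne'
  field_simp
  ring

section Expansion

/-- A linear map that kills `P 0, …, P (n - 1)`, where `P j` has degree `j`, kills all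
polynomials of degree less than `n`. -/
theorem linearMap_eq_zero_of_degree_lt {V : Type*} [AddCommGroup V] [Module ℝ V]
    {P : ℕ → ℝ[X]} (hP : ∀ n, (P n).degree = n) (L : ℝ[X] →ₗ[ℝ] V) {n : ℕ}
    (hL : ∀ j < n, L (P j) = 0) {g : ℝ[X]} (hg : g.degree < n) : L g = 0 := by
  induction n generalizing g with
  | zero =>
    rw [Nat.cast_zero, ← not_le, zero_le_degree_iff, not_not] at hg
    rw [hg, map_zero]
  | succ n ih =>
    have hlc : (P n).coeff n ≠ 0 := by
      have h := leadingCoeff_ne_zero.2 (show P n ≠ 0 from fun h => by simpa [h] using hP n)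
      rwa [leadingCoeff, natDegree_eq_of_degree_eq_some (hP n)] at h
    have hlt : (g - (g.coeff n / (P n).coeff n) • P n).degree < n := by
      rw [degree_lt_iff_coeff_zero]
      intro m hm
      rw [coeff_sub, coeff_smul, smul_eq_mul]
      rcases hm.eq_or_lt with rfl | hm
      · field_simp
        ring
      · rw [coeff_eq_zero_of_degree_lt (n := m), coeff_eq_zero_of_degree_lt (n := m)]
        · ring
        · rw [hP n]
          exact_mod_cast hm
        · exact hg.trans_le (by exact_mod_cast hm)
    have h := ih (fun j hj => hL j (hj.trans n.lt_succ_self)) hlt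
    rwa [map_sub, map_smul, hL n n.lt_succ_self, smul_zero, sub_zero] at h

variable {μ : Measure ℝ}

theorem integrable_eval_mul_eval (hint : ∀ p : ℝ[X], Integrable (fun x => p.eval x) μ)
    (g h : ℝ[X]) : Integrable (fun x => g.eval x * h.eval x) μ := by
  simpa only [eval_mul] using hint (g * h)

/-- The linear functional `g ↦ ∫ h g dμ`. -/
def innerFunctional (hint : ∀ p : ℝ[X], Integrable (fun x => p.eval x) μ) (h : ℝ[X]) :
    ℝ[X] →ₗ[ℝ] ℝ where
  toFun g := ∫ x, h.eval x * g.eval x ∂μ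
  map_add' g g' := by
    simp only [eval_add, mul_add]
    exact integral_add (integrable_eval_mul_eval hint h g) (integrable_eval_mul_eval hint h g')
  map_smul' a g := by
    simp only [eval_smul, smul_eq_mul, mul_left_comm _ a, integral_const_mul, RingHom.id_apply]

/-- The linear functional `g ↦ ⟨h, g⟩` of the discrete Sobolev inner product. -/
def sobFunctional (hint : ∀ p : ℝ[X], Integrable (fun x => p.eval x) μ) (c : ℝ) (r : ℕ)
    (M : ℕ → ℝ) (h : ℝ[X]) : ℝ[X] →ₗ[ℝ] ℝ where
  toFun g := sobInner μ c r M h g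
  map_add' g g' := by
    have := map_add (innerFunctional hint h) g g'
    simp only [innerFunctional, LinearMap.coe_mk, AddHom.coe_mk] at this
    rw [sobInner, sobInner, sobInner, this]
    simp only [iterate_map_add, eval_add, mul_add, Finset.sum_add_distrib]
    ring
  map_smul' a g := by
    have := map_smul (innerFunctional hint h) a g
    simp only [innerFunctional, LinearMap.coe_mk, AddHom.coe_mk] at this
    rw [sobInner, sobInner, this]
    simp only [iterate_derivative_smul, eval_smul, smul_eq_mul, mul_left_comm _ a,
      RingHom.id_apply, mul_add, Finset.mul_sum]

theorem IsOPS.eq_sum {p : ℕ → ℝ[X]} (hp : IsOPS μ p)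
    (hint : ∀ p : ℝ[X], Integrable (fun x => p.eval x) μ) {n : ℕ} {g : ℝ[X]}
    (hg : g.degree < n) :
    g = ∑ j ∈ Finset.range n, (∫ x, (p j).eval x * g.eval x ∂μ) • p j := by
  have h := linearMap_eq_zero_of_degree_lt hp.1 (n := n) (g := g)
    (LinearMap.id - ∑ j ∈ Finset.range n, (innerFunctional hint (p j)).smulRight (p j))
    (fun j hj => ?_) hg
  · simpa [innerFunctional, sub_eq_zero] using h
  · simp only [LinearMap.sub_apply, LinearMap.id_apply, LinearMap.sum_apply,
      LinearMap.smulRight_apply, innerFunctional, LinearMap.coe_mk, AddHom.coe_mk, hp.2.2,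
      ite_smul, one_smul, zero_smul]
    simp [hj]

/-- Expansion of a Sobolev orthonormal polynomial in terms of the orthonormal polynomials. -/
theorem IsSobOPS.exists_expansion {p q : ℕ → ℝ[X]} {c : ℝ} {r : ℕ} {M : ℕ → ℝ}
    (hp : IsOPS μ p) (hq : IsSobOPS μ c r M q)
    (hint : ∀ p : ℝ[X], Integrable (fun x => p.eval x) μ) (n : ℕ) :
    ∃ b : ℝ, 0 < b ∧
      (∀ k, (derivative^[k] (q n)).eval c = b * (derivative^[k] (p n)).eval c -
        ∑ i ∈ Finset.range (r + 1), M i * (derivative^[i] (q n)).eval c *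
          ∑ j ∈ Finset.range n, (derivative^[k] (p j)).eval c * (derivative^[i] (p j)).eval c) ∧
      b * (b + ∑ i ∈ Finset.range (r + 1),
        M i * (derivative^[i] (q n)).eval c * (derivative^[i] (p n)).eval c) = 1 := by
  have horth : ∀ g : ℝ[X], g.degree < n → sobInner μ c r M (q n) g = 0 := fun g hg =>
    linearMap_eq_zero_of_degree_lt hq.1 (sobFunctional hint c r M (q n))
      (fun j hj => (hq.2.2 n j).trans (if_neg hj.ne')) hg
  have hcoef : ∀ j < n, ∫ x, (p j).eval x * (q n).eval x ∂μ =
      -∑ i ∈ Finset.range (r + 1),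
        M i * (derivative^[i] (q n)).eval c * (derivative^[i] (p j)).eval c := fun j hj => by
    have h := horth (p j) (by rw [hp.1 j]; exact_mod_cast hj)
    simp only [sobInner, mul_comm (eval _ (q n)) (eval _ (p j))] at h
    linarith
  have hexp := hp.eq_sum hint (n := n + 1) (g := q n)
    (by rw [hq.1 n]; exact_mod_cast n.lt_succ_self)
  rw [Finset.sum_range_succ] at hexp
  set b := ∫ x, (p n).eval x * (q n).eval x ∂μ with hb
  have hdeg : (∑ j ∈ Finset.range n, (∫ x, (p j).eval x * (q n).eval x ∂μ) • p j).degree < n := by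
    rw [← mem_degreeLT]
    refine Submodule.sum_mem _ fun j hj => Submodule.smul_mem _ _ (mem_degreeLT.2 ?_)
    rw [hp.1 j]
    exact_mod_cast Finset.mem_range.1 hj
  refine ⟨b, ?_, fun k => ?_, ?_⟩
  · have h := congrArg (coeff · n) hexp
    simp only [coeff_add, coeff_eq_zero_of_degree_lt hdeg, zero_add, coeff_smul,
      smul_eq_mul] at h
    have hpn := hp.2.1 n
    have hqn := hq.2.1 n
    rw [leadingCoeff, natDegree_eq_of_degree_eq_some (hp.1 n)] at hpn
    rw [leadingCoeff, natDegree_eq_of_degree_eq_some (hq.1 n), h] at hqn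
    exact pos_of_mul_pos_left hqn hpn.le
  · have h := congrArg (fun g => (derivative^[k] g).eval c) hexp
    simp only [iterate_map_add, iterate_derivative_sum, iterate_derivative_smul, eval_add,
      eval_finsetSum, eval_smul, smul_eq_mul] at h
    rw [h, add_comm, sub_eq_add_neg]
    congr 1
    rw [Finset.sum_congr rfl fun j hj => by rw [hcoef j (Finset.mem_range.1 hj)]]
    simp only [neg_mul, Finset.sum_neg_distrib, Finset.sum_mul, Finset.mul_sum]
    rw [Finset.sum_comm]
    exact congrArg _ (Finset.sum_congr rfl fun i _ => Finset.sum_congr rfl fun j _ => by ring)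
  · have h1 := hq.2.2 n n
    rw [if_pos rfl] at h1
    have h2 : sobInner μ c r M (q n) (q n) = b * sobInner μ c r M (q n) (p n) := by
      have h := congrArg (sobFunctional hint c r M (q n)) hexp
      rw [map_add, map_smul] at h
      refine h.trans ?_
      rw [show sobFunctional hint c r M (q n) _ = 0 from horth _ hdeg, zero_add]
      rfl
    rw [h2, sobInner] at h1
    simpa only [mul_comm (eval _ (q n)) (eval _ (p n)), ← hb] using h1

end Expansion

section Asymptotics

variable {P : ℕ → ℕ → ℝ} {f C : ℕ → ℝ}

theorem tendsto_sum_mul_div_rpow (hf0 : ∀ k, 0 < 2 * f k + 1) (hC : ∀ k, C k ≠ 0)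
    (hlim : ∀ k, Tendsto (fun n : ℕ => P k n / ((-1 : ℝ) ^ n * (n : ℝ) ^ f k)) atTop (𝓝 (C k)))
    (k i : ℕ) :
    Tendsto (fun n : ℕ => (∑ j ∈ Finset.range n, P k j * P i j) /
      ((n : ℝ) ^ (f k + f i + 1) * C k * C i)) atTop (𝓝 (1 / (f k + f i + 1))) := by
  have hs : 0 < f k + f i + 1 := by linarith [hf0 k, hf0 i]
  have hu : Tendsto (fun n : ℕ => P k n * P i n / (n : ℝ) ^ (f k + f i)) atTop
      (𝓝 (C k * C i)) := by
    refine ((hlim k).mul (hlim i)).congr' ?_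
    filter_upwards [eventually_gt_atTop 0] with n hn
    rw [Real.rpow_add (Nat.cast_pos.2 hn), div_mul_div_comm, mul_mul_mul_comm, ← mul_pow]
    norm_num
  have hCC := mul_ne_zero (hC k) (hC i)
  have h := (tendsto_sum_range_div_rpow hs hu).div_const (C k * C i)
  rw [div_right_comm, div_self hCC] at h
  exact h.congr fun n => by rw [div_div, mul_assoc]

theorem tendsto_inv_rpow {a s : ℝ} (hs : 0 < s) :
    Tendsto (fun n : ℕ => (a * (n : ℝ) ^ s)⁻¹) atTop (𝓝 0) := by
  have h := (((tendsto_rpow_atTop hs).comp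
    (tendsto_natCast_atTop_atTop (R := ℝ))).inv_tendsto_atTop).const_mul a⁻¹
  rw [mul_zero] at h
  exact h.congr fun n => (mul_inv _ _).symm

theorem tendsto_ratio_of_expansion {Q : ℕ → ℕ → ℝ} {b M : ℕ → ℝ} {r : ℕ}
    (hM : ∀ i ≤ r, 0 ≤ M i) (hf : StrictMono f) (hf0 : 0 < 2 * f 0 + 1) (hC : ∀ k, C k ≠ 0)
    (hlim : ∀ k, Tendsto (fun n : ℕ => P k n / ((-1 : ℝ) ^ n * (n : ℝ) ^ f k)) atTop (𝓝 (C k)))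
    (hb : ∀ n, 0 < b n)
    (hQ : ∀ n k, Q k n = b n * P k n -
      ∑ i ∈ Finset.range (r + 1), M i * Q i n * ∑ j ∈ Finset.range n, P k j * P i j)
    (hnorm : ∀ n, b n * (b n + ∑ i ∈ Finset.range (r + 1), M i * Q i n * P i n) = 1) :
    (∀ k ≤ r, 0 < M k → ∃ D : ℝ, D ≠ 0 ∧
      Tendsto (fun n : ℕ => (n : ℝ) ^ (2 * f k + 1) * (Q k n / P k n)) atTop (𝓝 D)) ∧
    (∀ k : ℕ, (r < k ∨ M k = 0) → ∃ D : ℝ, D ≠ 0 ∧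
      Tendsto (fun n : ℕ => Q k n / P k n) atTop (𝓝 D)) := by
  have hfpos : ∀ k, 0 < 2 * f k + 1 := fun k => by linarith [hf.monotone (Nat.zero_le k)]
  set S : Finset ℕ := (Finset.range (r + 1)).filter (fun i => 0 < M i) with hS
  have hsum : ∀ F : ℕ → ℝ, ∑ i ∈ Finset.range (r + 1), M i * F i = ∑ i : S, M i * F i := by
    intro F
    rw [Finset.sum_coe_sort S fun i => M i * F i]
    refine (Finset.sum_filter_of_ne fun i hi h => ?_).symm
    exact (hM i (Finset.mem_range_succ_iff.1 hi)).lt_of_ne' (left_ne_zero_of_mul h)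
  have hMS : ∀ i : S, M i ≠ 0 := fun i => (Finset.mem_filter.1 i.2).2.ne'
  let y : ℕ → ℕ → ℝ := fun k n => P k n / ((-1 : ℝ) ^ n * (n : ℝ) ^ f k) / C k
  let κ : ℕ → ℕ → ℕ → ℝ := fun k i n => (∑ j ∈ Finset.range n, P k j * P i j) /
    ((n : ℝ) ^ (f k + f i + 1) * C k * C i)
  let x : ℕ → S → ℝ := fun n i => M i * (Q i n / b n) * ((n : ℝ) ^ (f i + 1) * C i * (-1) ^ n)
  let z : ℕ → ℕ → ℝ := fun k n => Q k n / b n / ((-1 : ℝ) ^ n * (n : ℝ) ^ f k) / C k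
  let d : S → ℕ → ℝ := fun k n => (M k * C k ^ 2 * (n : ℝ) ^ (2 * f k + 1))⁻¹
  have hy : ∀ k, Tendsto (y k) atTop (𝓝 1) := fun k => by
    simpa only [div_self (hC k)] using (hlim k).div_const (C k)
  have hκ : ∀ k i, Tendsto (κ k i) atTop (𝓝 (1 / (f k + f i + 1))) :=
    tendsto_sum_mul_div_rpow hfpos hC hlim
  have hd : ∀ k, Tendsto (d k) atTop (𝓝 0) := fun k => tendsto_inv_rpow (hfpos k)
  have hz : ∀ k n, 0 < n → z k n = y k n - ∑ i : S, κ k i n * x n i := by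
    intro k n hn
    have hn' : (0 : ℝ) < n := Nat.cast_pos.2 hn
    have hbn := (hb n).ne'
    have hQ' : Q k n / b n = P k n -
        ∑ i : S, M i * (Q i n / b n * ∑ j ∈ Finset.range n, P k j * P i j) := by
      have h := hQ n k
      simp only [mul_assoc] at h
      rw [hsum fun i => Q i n * ∑ j ∈ Finset.range n, P k j * P i j] at h
      rw [h, sub_div, mul_div_cancel_left₀ _ hbn, Finset.sum_div]
      exact congrArg _ (Finset.sum_congr rfl fun i _ => by ring)
    simp only [z, hQ', sub_div, Finset.sum_div, y]
    refine congrArg _ (Finset.sum_congr rfl fun i _ => ?_)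
    simp only [κ, x]
    have h1 := (Real.rpow_pos_of_pos hn' (f k)).ne'
    have h2 := (Real.rpow_pos_of_pos hn' (f i + 1)).ne'
    have h3 := hC k
    have h4 := hC i
    have h5 : ((-1 : ℝ) ^ n) ^ 2 = 1 := by rw [← pow_mul, mul_comm, pow_mul]; norm_num
    have h6 : (-1 : ℝ) ^ n ≠ 0 := pow_ne_zero _ (by norm_num)
    rw [add_assoc (f k), Real.rpow_add hn']
    field_simp
    rw [h5, mul_one]
  have hxz : ∀ (k : S) n, 0 < n → z k n = d k n * x n k := by
    intro k n hn
    have hn' : (0 : ℝ) < n := Nat.cast_pos.2 hn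
    have hbn := (hb n).ne'
    simp only [z, d, x]
    have h1 := (Real.rpow_pos_of_pos hn' (f k)).ne'
    have h3 := hC k
    have h5 : ((-1 : ℝ) ^ n) ^ 2 = 1 := by rw [← pow_mul, mul_comm, pow_mul]; norm_num
    have h6 : (-1 : ℝ) ^ n ≠ 0 := pow_ne_zero _ (by norm_num)
    have h7 := hMS k
    rw [show 2 * f k + 1 = f k + (f k + 1) by ring, Real.rpow_add hn', Real.rpow_add_one hn'.ne']
    field_simp
    rw [h5, mul_one]
  let g : S → ℝ := fun i => f i
  have hg : Function.Injective g := hf.injective.comp Subtype.val_injective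
  have hgpos : ∀ i, 0 < 2 * g i + 1 := fun i => hfpos i
  let H : Matrix S S ℝ := Matrix.of fun k i => 1 / (g k + g i + 1)
  have hdet : H.det ≠ 0 := cauchy_det_ne_zero hg hgpos
  let A : ℕ → Matrix S S ℝ := fun n =>
    (Matrix.of fun k i : S => κ k i n) + Matrix.diagonal fun k => d k n
  have hA : Tendsto A atTop (𝓝 H) := by
    refine tendsto_pi_nhds.2 fun k => tendsto_pi_nhds.2 fun i => ?_
    simp only [A, Matrix.add_apply, Matrix.of_apply, Matrix.diagonal_apply, H]
    rw [← add_zero (1 / (g k + g i + 1))]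
    refine (hκ k i).add ?_
    split_ifs
    exacts [hd k, tendsto_const_nhds]
  have hx : Tendsto x atTop (𝓝 (H⁻¹.mulVec fun _ => 1)) := by
    refine tendsto_of_mulVec_tendsto (y := fun n (k : S) => y k n) hA hdet
      (tendsto_pi_nhds.2 fun k => hy k) ?_
    filter_upwards [eventually_gt_atTop 0] with n hn
    funext k
    simp only [A]
    rw [Matrix.add_mulVec, Pi.add_apply, Matrix.mulVec_diagonal, ← hxz k n hn, hz k n hn]
    exact add_sub_cancel _ _
  set ξ : S → ℝ := H⁻¹.mulVec fun _ => 1 with hξ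
  have hxi : ∀ i, Tendsto (fun n => x n i) atTop (𝓝 (ξ i)) := tendsto_pi_nhds.1 hx
  have hξsum : ∀ k, ∑ i, ξ i / (g k + g i + 1) = 1 := by
    intro k
    have h : H.mulVec ξ = fun _ => 1 := by
      rw [hξ, Matrix.mulVec_mulVec, Matrix.mul_nonsing_inv _ hdet.isUnit, Matrix.one_mulVec]
    simpa [H, Matrix.mulVec, dotProduct, div_eq_inv_mul] using congrFun h k
  have hb1 : Tendsto b atTop (𝓝 1) := by
    have h1 : Tendsto (fun n : ℕ => 1 + (∑ i : S, x n i * y i n) * (n : ℝ)⁻¹) atTop (𝓝 1) := by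
      simpa using ((tendsto_finsetSum Finset.univ fun i _ => (hxi i).mul (hy i)).mul
        (tendsto_inv_atTop_nhds_zero_nat (𝕜 := ℝ))).const_add 1
    have h2 := (h1.inv₀ one_ne_zero).sqrt
    rw [inv_one, Real.sqrt_one] at h2
    refine h2.congr' ?_
    filter_upwards [eventually_gt_atTop 0] with n hn
    have hn' : (0 : ℝ) < n := Nat.cast_pos.2 hn
    have hbn := (hb n).ne'
    have h3 : b n ^ 2 * (1 + (∑ i : S, x n i * y i n) * (n : ℝ)⁻¹) = 1 := by
      have h := hnorm n
      simp only [mul_assoc] at h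
      rw [hsum fun i => Q i n * P i n] at h
      refine Eq.trans ?_ h
      rw [sq, mul_assoc, mul_add (b n) 1, mul_one, Finset.sum_mul, Finset.mul_sum]
      congr 2
      refine Finset.sum_congr rfl fun i _ => ?_
      have h4 := (Real.rpow_pos_of_pos hn' (f i)).ne'
      have h5 := hC i
      have h6 : (-1 : ℝ) ^ n ≠ 0 := pow_ne_zero _ (by norm_num)
      simp only [x, y]
      rw [Real.rpow_add_one hn'.ne']
      field_simp
    rw [← eq_inv_of_mul_eq_one_left h3, Real.sqrt_sq (hb n).le]
  have hratio : ∀ k n, 0 < n → Q k n / P k n = b n * (z k n / y k n) := by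
    intro k n hn
    have hbn := (hb n).ne'
    have h1 := (Real.rpow_pos_of_pos (Nat.cast_pos.2 hn : (0 : ℝ) < n) (f k)).ne'
    have h6 : (-1 : ℝ) ^ n ≠ 0 := pow_ne_zero _ (by norm_num)
    simp only [z, y]
    rw [div_div_div_cancel_right₀ (hC k), div_div_div_cancel_right₀ (mul_ne_zero h6 h1),
      div_right_comm, mul_div_cancel₀ _ hbn]
  constructor
  · intro k hkr hMk
    let k' : S := ⟨k, Finset.mem_filter.2 ⟨Finset.mem_range_succ_iff.2 hkr, hMk⟩⟩
    have hMC : M k * C k ^ 2 ≠ 0 := mul_ne_zero hMk.ne' (pow_ne_zero _ (hC k))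
    refine ⟨1 * (ξ k' / (M k * C k ^ 2) / 1), ?_, ?_⟩
    · rw [one_mul, div_one]
      exact div_ne_zero (cauchy_solution_ne_zero hg hgpos hξsum k') hMC
    · refine (hb1.mul (((hxi k').div_const (M k * C k ^ 2)).div (hy k) one_ne_zero)).congr' ?_
      filter_upwards [eventually_gt_atTop 0] with n hn
      have h1 := (Real.rpow_pos_of_pos (Nat.cast_pos.2 hn : (0 : ℝ) < n) (2 * f k + 1)).ne'
      change b n * (x n k' / (M k * C k ^ 2) / y k n) = _
      rw [hratio k n hn, hxz k' n hn]
      simp only [d, k']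
      field_simp
  · intro k hk
    have hkS : ∀ i : S, f k ≠ g i := fun i h => by
      have hi := Finset.mem_filter.1 i.2
      rw [← hf.injective h, Finset.mem_range_succ_iff] at hi
      exact hk.elim hi.1.not_gt hi.2.ne'
    refine ⟨1 * ((1 - ∑ i, ξ i / (f k + g i + 1)) / 1), ?_, ?_⟩
    · rw [one_mul, div_one]
      exact cauchy_partialFraction_ne_zero hg hgpos hξsum (hfpos k) hkS
    · have hzlim : Tendsto (fun n => y k n - ∑ i : S, κ k i n * x n i) atTop
          (𝓝 (1 - ∑ i, ξ i / (f k + g i + 1))) := by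
        refine (hy k).sub (tendsto_finsetSum _ fun i _ => ?_)
        rw [← one_div_mul_eq_div]
        exact (hκ k i).mul (hxi i)
      refine (hb1.mul (hzlim.div (hy k) one_ne_zero)).congr' ?_
      filter_upwards [eventually_gt_atTop 0] with n hn
      rw [hratio k n hn, hz k n hn]
      rfl

end Asymptotics

/-- **Lemma 2.** If `p_n^{(k)}(c) ≅ C_k (-1)^n n^{f(k)}` for a strictly increasing `f`
with `2f(0)+1 > 0`, then `q_n^{(k)}(c)/p_n^{(k)}(c) ≅ C_k n^{-(2f(k)+1)}` when `M_k > 0`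
(`k ≤ r`), and `q_n^{(k)}(c)/p_n^{(k)}(c) ≅ C_k` otherwise. -/
theorem ratio_of_derivatives_asymptotics
    (μ : Measure ℝ) [IsFiniteMeasure μ]
    (hsupp : (measSupport μ).Infinite)
    (hint : ∀ p : Polynomial ℝ, Integrable (fun x => p.eval x) μ)
    (c : ℝ) (r : ℕ) (M : ℕ → ℝ) (hM : ∀ i ≤ r, 0 ≤ M i)
    (p : ℕ → Polynomial ℝ) (hp : IsOPS μ p)
    (q : ℕ → Polynomial ℝ) (hq : IsSobOPS μ c r M q)
    (f : ℕ → ℝ) (hf : StrictMono f) (hf0 : 0 < 2 * f 0 + 1)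
    (C : ℕ → ℝ) (hC : ∀ k, C k ≠ 0)
    (hlim : ∀ k, Filter.Tendsto
      (fun n : ℕ => (Polynomial.derivative^[k] (p n)).eval c / ((-1 : ℝ) ^ n * (n : ℝ) ^ (f k)))
      Filter.atTop (nhds (C k))) :
    (∀ k ≤ r, 0 < M k → ∃ D : ℝ, D ≠ 0 ∧ Filter.Tendsto
      (fun n : ℕ => (n : ℝ) ^ (2 * f k + 1) *
        ((Polynomial.derivative^[k] (q n)).eval c / (Polynomial.derivative^[k] (p n)).eval c))
      Filter.atTop (nhds D)) ∧
    (∀ k : ℕ, (r < k ∨ M k = 0) → ∃ D : ℝ, D ≠ 0 ∧ Filter.Tendsto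
      (fun n : ℕ =>
        (Polynomial.derivative^[k] (q n)).eval c / (Polynomial.derivative^[k] (p n)).eval c)
      Filter.atTop (nhds D)) := by
  choose b hb hexp hnorm using hq.exists_expansion hp hint
  exact tendsto_ratio_of_expansion hM hf hf0 hC hlim hb hexp hnorm
end
end

section
/- Suppose there is a strictly increasing function f: ℕ → ℝ with 2f(0)+1 > 0 such that for every integer k ≥ 0 there exists a nonzero constant C_k with lim_{n→∞} p_n^{(k)}(c) / ((−1)^n n^{f(k)}) = C_k. Let j_1 < j_2 < … < j_s be exactly the indices i ∈ {0,…,r} with M_i > 0. Then lim_{n→∞} q_n^{(r+1)}(c) / p_n^{(r+1)}(c) = ∏_{i=1}^{s} (f(r+1) − f(j_i)) / (f(r+1) + f(j_i) + 1). -/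
open MeasureTheory Polynomial Filter Topology

noncomputable section
/-! ### Cauchy systems -/

section Cauchy

variable {ι : Type*} [Fintype ι] [DecidableEq ι]

/-- The polynomial `∑ i, u i * ∏ l ≠ i, (X + b l)`, numerator of `∑ i, u i / (X + b i)`. -/
def cauchyNumerator (b u : ι → ℝ) : ℝ[X] :=
  ∑ i, C (u i) * ∏ l ∈ Finset.univ.erase i, (X + C (b l))

lemma degree_cauchyNumerator_lt (b u : ι → ℝ) :
    (cauchyNumerator b u).degree < (Finset.univ : Finset ι).card := by
  refine (degree_sum_le _ _).trans_lt ((Finset.sup_lt_iff (WithBot.bot_lt_coe _)).2 fun i hi => ?_)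
  rw [← smul_eq_C_mul]
  refine (degree_smul_le _ _).trans_lt ?_
  simp only [degree_prod, degree_X_add_C, Finset.sum_const, nsmul_eq_mul, mul_one]
  exact_mod_cast Finset.card_erase_lt_of_mem hi

lemma eval_cauchyNumerator (b u : ι → ℝ) (x : ℝ) (hx : ∀ l, x + b l ≠ 0) :
    (cauchyNumerator b u).eval x = (∏ l, (x + b l)) * ∑ i, (x + b i)⁻¹ * u i := by
  simp only [cauchyNumerator, eval_finsetSum, eval_mul, eval_C, eval_prod, eval_add, eval_X,
    Finset.mul_sum]
  refine Finset.sum_congr rfl fun i _ => ?_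
  rw [← Finset.mul_prod_erase Finset.univ (fun l => x + b l) (Finset.mem_univ i)]
  field_simp [hx i]

lemma eval_cauchyNumerator_neg (b u : ι → ℝ) (i : ι) :
    (cauchyNumerator b u).eval (-b i) =
      u i * ∏ l ∈ Finset.univ.erase i, (-b i + b l) := by
  simp only [cauchyNumerator, eval_finsetSum, eval_mul, eval_C, eval_prod, eval_add, eval_X]
  refine Finset.sum_eq_single i (fun j _ hj => ?_) (by simp)
  rw [Finset.prod_eq_zero (Finset.mem_erase.2 ⟨hj.symm, Finset.mem_univ i⟩) (by ring), mul_zero]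

lemma cauchy_det_ne_zero_s2 {a b : ι → ℝ} (ha : Function.Injective a) (hb : Function.Injective b)
    (hab : ∀ j i, a j + b i ≠ 0) : (Matrix.of fun j i => (a j + b i)⁻¹).det ≠ 0 := by
  intro hdet
  obtain ⟨u, hu, hAu⟩ := Matrix.exists_mulVec_eq_zero_iff.2 hdet
  have hzero : cauchyNumerator b u = 0 := by
    refine eq_zero_of_degree_lt_of_eval_index_eq_zero (s := Finset.univ) ha.injOn
      (degree_cauchyNumerator_lt b u) fun j _ => ?_
    have h : ∑ i, (a j + b i)⁻¹ * u i = 0 := congrFun hAu j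
    rw [eval_cauchyNumerator b u _ (hab j), h, mul_zero]
  refine hu (funext fun i => ?_)
  have h := eval_cauchyNumerator_neg b u i
  rw [hzero, eval_zero, eq_comm, mul_eq_zero] at h
  refine h.resolve_right (Finset.prod_ne_zero_iff.2 fun l hl h0 => ?_)
  exact (Finset.mem_erase.1 hl).1 (hb (by linarith))

lemma one_sub_cauchy_sum_eq_prod {a b u : ι → ℝ} (ha : Function.Injective a)
    (hab : ∀ j i, a j + b i ≠ 0) (hu : ∀ j, ∑ i, (a j + b i)⁻¹ * u i = 1)
    {x : ℝ} (hx : ∀ i, x + b i ≠ 0) :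
    1 - ∑ i, (x + b i)⁻¹ * u i = ∏ i, (x - a i) / (x + b i) := by
  have hmA : (∏ i, (X - C (a i))).Monic := monic_prod_of_monic _ _ fun i _ => monic_X_sub_C _
  have hmB : (∏ i, (X + C (b i))).Monic := monic_prod_of_monic _ _ fun i _ => monic_X_add_C _
  have hdA : (∏ i, (X - C (a i))).degree = ((Finset.univ : Finset ι).card : WithBot ℕ) := by
    simp [degree_prod]
  have hdB : (∏ i, (X + C (b i))).degree = ((Finset.univ : Finset ι).card : WithBot ℕ) := by
    simp [degree_prod]
  have key : (∏ i, (X + C (b i))) - (∏ i, (X - C (a i))) = cauchyNumerator b u := by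
    refine eq_of_degrees_lt_of_eval_index_eq (s := Finset.univ) ha.injOn ?_
      (degree_cauchyNumerator_lt b u) fun j _ => ?_
    · rw [← hdB]
      exact degree_sub_lt_left (hdB.trans hdA.symm) hmB.ne_zero
        (hmB.leadingCoeff.trans hmA.leadingCoeff.symm)
    · rw [eval_cauchyNumerator b u _ (hab j), hu j, eval_sub, eval_prod, eval_prod,
        Finset.prod_eq_zero (i := j) (f := fun i => eval (a j) (X - C (a i)))
          (Finset.mem_univ j) (by simp)]
      simp
  have h := congrArg (eval x) key
  have hne : ∏ i, (x + b i) ≠ 0 := Finset.prod_ne_zero_iff.2 fun i _ => hx i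
  rw [eval_cauchyNumerator b u _ hx] at h
  simp only [eval_sub, eval_prod, eval_add, eval_X, eval_C] at h
  rw [Finset.prod_div_distrib, eq_div_iff hne]
  linarith

/-- Solutions of convergent linear systems with invertible limit converge. -/
lemma tendsto_of_mulVec_eventuallyEq {α : Type*} {l : Filter α} {A : α → Matrix ι ι ℝ}
    {A₀ : Matrix ι ι ℝ} {u b : α → ι → ℝ} {b₀ : ι → ℝ} (hA : Tendsto A l (𝓝 A₀))
    (hb : Tendsto b l (𝓝 b₀)) (hdet : A₀.det ≠ 0) (h : ∀ᶠ n in l, (A n).mulVec (u n) = b n) :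
    Tendsto u l (𝓝 (A₀⁻¹.mulVec b₀)) := by
  have hdetn : Tendsto (fun n => (A n).det) l (𝓝 A₀.det) :=
    (continuous_id.matrix_det.tendsto A₀).comp hA
  have hinv : Tendsto (fun n => (A n)⁻¹) l (𝓝 A₀⁻¹) := by
    refine Tendsto.comp (g := fun B : Matrix ι ι ℝ => B⁻¹) (continuousAt_matrix_inv _ ?_) hA
    rw [Ring.inverse_eq_inv']
    exact continuousAt_inv₀ hdet
  have hmul : Tendsto (fun n => (A n)⁻¹.mulVec (b n)) l (𝓝 (A₀⁻¹.mulVec b₀)) := by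
    rw [tendsto_pi_nhds] at *
    intro j
    simp only [Matrix.mulVec, dotProduct]
    exact tendsto_finsetSum _ fun i _ =>
      (((continuous_id.matrix_elem j i).tendsto A₀⁻¹).comp hinv).mul (hb i)
  refine hmul.congr' ?_
  filter_upwards [h, hdetn.eventually_ne hdet] with n hn hd
  rw [← hn, Matrix.mulVec_mulVec, Matrix.nonsing_inv_mul _ (isUnit_iff_ne_zero.2 hd),
    Matrix.one_mulVec]

end Cauchy

/-! ### Partial sums of sequences with power growth -/

lemma tendsto_sum_div_rpow {a : ℕ → ℝ} {α L : ℝ} (hα : 0 < α + 1)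
    (ha : Tendsto (fun n : ℕ => a n / (n : ℝ) ^ α) atTop (𝓝 L)) :
    Tendsto (fun n : ℕ => (∑ m ∈ Finset.range n, a m) / (n : ℝ) ^ (α + 1)) atTop
      (𝓝 (L / (α + 1))) := by
  set b : ℕ → ℝ := fun m => ((m + 1 : ℕ) : ℝ) ^ (α + 1) - (m : ℝ) ^ (α + 1) with hbdef
  have hb0 : ∀ m, 0 < b m := fun m =>
    sub_pos.2 (Real.rpow_lt_rpow (Nat.cast_nonneg m) (by simp) hα)
  have hbsum : ∀ n, ∑ m ∈ Finset.range n, b m = (n : ℝ) ^ (α + 1) := fun n => by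
    rw [Finset.sum_range_sub (fun m : ℕ => (m : ℝ) ^ (α + 1))]
    simp [Real.zero_rpow hα.ne']
  have hpow : Tendsto (fun n : ℕ => (n : ℝ) ^ (α + 1)) atTop atTop :=
    (tendsto_rpow_atTop hα).comp tendsto_natCast_atTop_atTop
  have hbα : Tendsto (fun n : ℕ => b n / (n : ℝ) ^ α) atTop (𝓝 (α + 1)) := by
    have hder : HasDerivAt (fun x : ℝ => x ^ (α + 1)) (α + 1) 1 := by
      simpa using Real.hasDerivAt_rpow_const (x := 1) (p := α + 1) (Or.inl one_ne_zero)
    have hslope := hder.tendsto_slope_zero_right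
    have hinv : Tendsto (fun n : ℕ => ((n : ℝ))⁻¹) atTop (𝓝[>] 0) :=
      tendsto_inv_atTop_nhdsGT_zero.comp tendsto_natCast_atTop_atTop
    refine (hslope.comp hinv).congr' ?_
    filter_upwards [eventually_gt_atTop 0] with n hn
    have hn' : (0 : ℝ) < n := by exact_mod_cast hn
    have h1 : ((n + 1 : ℕ) : ℝ) = n * (1 + (n : ℝ)⁻¹) := by
      push_cast
      field_simp
    have hne : (n : ℝ) ^ α ≠ 0 := (Real.rpow_pos_of_pos hn' _).ne'
    simp only [Function.comp, hbdef, smul_eq_mul, inv_inv, Real.one_rpow]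
    rw [h1, Real.mul_rpow hn'.le (by positivity), Real.rpow_add_one hn'.ne']
    field_simp
  have hratio : Tendsto (fun n => a n / b n) atTop (𝓝 (L / (α + 1))) := by
    refine (ha.div hbα hα.ne').congr' ?_
    filter_upwards [eventually_gt_atTop 0] with n hn
    have hn' : (0 : ℝ) < n := by exact_mod_cast hn
    exact div_div_div_cancel_right₀ (Real.rpow_pos_of_pos hn' _).ne' _ _
  have hlittle : (fun n => a n - L / (α + 1) * b n) =o[atTop] b := by
    rw [Asymptotics.isLittleO_iff_tendsto fun n h => absurd h (hb0 n).ne']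
    have h0 := hratio.sub_const (L / (α + 1))
    rw [sub_self] at h0
    refine h0.congr fun n => ?_
    rw [sub_div, mul_div_cancel_right₀ _ (hb0 n).ne']
  have hsum := hlittle.sum_range (fun n => (hb0 n).le) (by simpa only [hbsum] using hpow)
  have hdiv := hsum.tendsto_div_nhds_zero.add_const (L / (α + 1))
  rw [zero_add] at hdiv
  refine hdiv.congr' ?_
  filter_upwards [eventually_gt_atTop 0] with n hn
  have hn' : (0 : ℝ) < n := by exact_mod_cast hn
  have hne : (n : ℝ) ^ (α + 1) ≠ 0 := (Real.rpow_pos_of_pos hn' _).ne'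
  rw [Finset.sum_sub_distrib, ← Finset.mul_sum, hbsum, sub_div, mul_div_cancel_right₀ _ hne]
  ring
/-! ### Expansions in orthonormal polynomials -/

lemma exists_eq_sum_smul_of_degree_lt {P : ℕ → ℝ[X]} (hP : ∀ n, (P n).degree = n) (n : ℕ) :
    ∀ g : ℝ[X], g.degree < n → ∃ b : ℕ → ℝ, g = ∑ m ∈ Finset.range n, b m • P m := by
  induction n with
  | zero =>
    intro g hg
    exact ⟨0, by simpa using hg⟩
  | succ n ih =>
    intro g hg
    have hlead : (P n).coeff n ≠ 0 := by
      have h := leadingCoeff_ne_zero.2 (ne_zero_of_degree_gt ((WithBot.bot_lt_coe n).trans_eq (hP n).symm))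
      rwa [leadingCoeff, natDegree_eq_of_degree_eq_some (hP n)] at h
    set a := g.coeff n / (P n).coeff n with ha
    have hdeg : (g - a • P n).degree < n := by
      rw [degree_lt_iff_coeff_zero]
      intro m hm
      rcases hm.eq_or_lt with rfl | hm
      · simp [ha, hlead]
      · have h1 : g.coeff m = 0 := coeff_eq_zero_of_degree_lt (hg.trans_le (by exact_mod_cast hm))
        have h2 : (P n).coeff m = 0 :=
          coeff_eq_zero_of_degree_lt ((hP n).trans_lt (by exact_mod_cast hm))
        simp [h1, h2]
    obtain ⟨b, hb⟩ := ih _ hdeg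
    refine ⟨Function.update b n a, ?_⟩
    rw [Finset.sum_range_succ, Function.update_self, eq_comm, ← eq_sub_iff_add_eq, hb]
    refine Finset.sum_congr rfl fun m hm => ?_
    rw [Function.update_of_ne (Finset.mem_range.1 hm).ne]

lemma eval_iterate_derivative_sum_smul (s : Finset ℕ) (b : ℕ → ℝ) (P : ℕ → ℝ[X]) (k : ℕ) (c : ℝ) :
    (derivative^[k] (∑ m ∈ s, b m • P m)).eval c =
      ∑ m ∈ s, b m * (derivative^[k] (P m)).eval c := by
  simp only [iterate_derivative_sum, iterate_derivative_smul, eval_finsetSum, eval_smul,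
    smul_eq_mul]

lemma integral_eval_mul_sum_smul {μ : Measure ℝ}
    (hint : ∀ p : ℝ[X], Integrable (fun x => p.eval x) μ)
    (s : Finset ℕ) (b : ℕ → ℝ) (P : ℕ → ℝ[X]) (g : ℝ[X]) :
    ∫ x, g.eval x * (∑ m ∈ s, b m • P m).eval x ∂μ =
      ∑ m ∈ s, b m * ∫ x, g.eval x * (P m).eval x ∂μ := by
  simp only [← integral_const_mul]
  rw [← integral_finsetSum]
  · refine integral_congr_ae (Eventually.of_forall fun x => ?_)
    simp only [eval_finsetSum, eval_smul, smul_eq_mul, Finset.mul_sum]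
    exact Finset.sum_congr rfl fun m _ => by ring
  · intro m _
    simpa using (hint (g * P m)).const_mul (b m)

lemma sobInner_sum_smul {μ : Measure ℝ}
    (hint : ∀ p : ℝ[X], Integrable (fun x => p.eval x) μ) (c : ℝ) (r : ℕ) (M : ℕ → ℝ)
    (s : Finset ℕ) (b : ℕ → ℝ) (P : ℕ → ℝ[X]) (g : ℝ[X]) :
    sobInner μ c r M g (∑ m ∈ s, b m • P m) = ∑ m ∈ s, b m * sobInner μ c r M g (P m) := by
  simp only [sobInner, mul_add, Finset.sum_add_distrib, integral_eval_mul_sum_smul hint,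
    eval_iterate_derivative_sum_smul, Finset.mul_sum]
  rw [Finset.sum_comm (s := s)]
  congr 1
  exact Finset.sum_congr rfl fun i _ => Finset.sum_congr rfl fun m _ => by ring

lemma sobInner_eq_sum_filter_pos {M : ℕ → ℝ} {r : ℕ} (hM : ∀ i ≤ r, 0 ≤ M i) (μ : Measure ℝ)
    (c : ℝ) (g h : ℝ[X]) :
    sobInner μ c r M g h = (∫ x, g.eval x * h.eval x ∂μ) +
      ∑ i ∈ (Finset.range (r + 1)).filter (fun i => 0 < M i),
        M i * (derivative^[i] g).eval c * (derivative^[i] h).eval c := by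
  rw [sobInner, Finset.sum_filter_of_ne]
  intro i hi hne
  refine (hM i (Finset.mem_range_succ_iff.1 hi)).lt_of_ne fun h0 => hne ?_
  rw [← h0, zero_mul, zero_mul]

/-- The Sobolev orthonormal polynomial of degree `n` in terms of `p n` and the kernels of `μ`. -/
lemma exists_sobolev_connection {μ : Measure ℝ}
    (hint : ∀ p : ℝ[X], Integrable (fun x => p.eval x) μ)
    {c : ℝ} {r : ℕ} {M : ℕ → ℝ} (hM : ∀ i ≤ r, 0 ≤ M i)
    {p : ℕ → ℝ[X]} (hp : IsOPS μ p) {q : ℕ → ℝ[X]} (hq : IsSobOPS μ c r M q) (n : ℕ) :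
    ∃ γ : ℝ, 0 < γ ∧
      (∀ k, (derivative^[k] (q n)).eval c = γ * (derivative^[k] (p n)).eval c -
        ∑ i ∈ (Finset.range (r + 1)).filter (fun i => 0 < M i),
          M i * (derivative^[i] (q n)).eval c * ∑ m ∈ Finset.range n,
            (derivative^[i] (p m)).eval c * (derivative^[k] (p m)).eval c) ∧
      γ * (γ + ∑ i ∈ (Finset.range (r + 1)).filter (fun i => 0 < M i),
        M i * (derivative^[i] (q n)).eval c * (derivative^[i] (p n)).eval c) = 1 := by
  obtain ⟨hpd, hpl, hpo⟩ := hp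
  obtain ⟨hqd, hql, hqo⟩ := hq
  obtain ⟨b, hb⟩ := exists_eq_sum_smul_of_degree_lt hpd (n + 1) (q n)
    ((hqd n).trans_lt (by exact_mod_cast n.lt_succ_self))
  have hcoef : ∀ m ≤ n, ∫ x, (q n).eval x * (p m).eval x ∂μ = b m := by
    intro m hm
    have h := integral_eval_mul_sum_smul hint (Finset.range (n + 1)) b p (p m)
    rw [← hb] at h
    simp only [hpo, mul_ite, mul_one, mul_zero, Finset.sum_ite_eq, Finset.mem_range] at h
    rw [if_pos (Nat.lt_succ_of_le hm)] at h
    rw [← h]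
    exact integral_congr_ae (Eventually.of_forall fun x => mul_comm _ _)
  have horth : ∀ m < n, sobInner μ c r M (q n) (p m) = 0 := by
    intro m hm
    obtain ⟨a, ha⟩ := exists_eq_sum_smul_of_degree_lt hqd (m + 1) (p m)
      ((hpd m).trans_lt (by exact_mod_cast m.lt_succ_self))
    rw [ha, sobInner_sum_smul hint]
    refine Finset.sum_eq_zero fun l hl => ?_
    have := Finset.mem_range.1 hl
    rw [hqo, if_neg (by omega), mul_zero]
  have hnorm : b n * sobInner μ c r M (q n) (p n) = 1 := by
    have h : sobInner μ c r M (q n) (q n) = 1 := by simp [hqo]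
    nth_rewrite 2 [hb] at h
    rw [sobInner_sum_smul hint, Finset.sum_range_succ, Finset.sum_eq_zero, zero_add] at h
    · exact h
    · intro m hm
      rw [horth m (Finset.mem_range.1 hm), mul_zero]
  refine ⟨b n, ?_, fun k => ?_, ?_⟩
  · have hpn := hpl n
    have hqn := hql n
    rw [leadingCoeff, natDegree_eq_of_degree_eq_some (hpd n)] at hpn
    rw [leadingCoeff, natDegree_eq_of_degree_eq_some (hqd n), hb, finsetSum_coeff,
      Finset.sum_range_succ, Finset.sum_eq_zero, zero_add, coeff_smul, smul_eq_mul] at hqn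
    · exact pos_of_mul_pos_left hqn hpn.le
    · intro m hm
      rw [coeff_smul, coeff_eq_zero_of_degree_lt, smul_zero]
      exact (hpd m).trans_lt (by exact_mod_cast Finset.mem_range.1 hm)
  · have hlow : ∀ m ∈ Finset.range n, b m * (derivative^[k] (p m)).eval c =
        -∑ i ∈ (Finset.range (r + 1)).filter (fun i => 0 < M i),
          M i * (derivative^[i] (q n)).eval c *
            ((derivative^[i] (p m)).eval c * (derivative^[k] (p m)).eval c) := by
      intro m hm
      have h := horth m (Finset.mem_range.1 hm)
      rw [sobInner_eq_sum_filter_pos hM, hcoef m (Finset.mem_range.1 hm).le] at h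
      rw [eq_neg_of_add_eq_zero_left h, neg_mul, Finset.sum_mul]
      exact congrArg _ (Finset.sum_congr rfl fun i _ => by ring)
    have h := eval_iterate_derivative_sum_smul (Finset.range (n + 1)) b p k c
    rw [← hb, Finset.sum_range_succ, Finset.sum_congr rfl hlow, Finset.sum_neg_distrib,
      Finset.sum_comm] at h
    simp only [Finset.mul_sum]
    linarith
  · rwa [sobInner_eq_sum_filter_pos hM, hcoef n le_rfl] at hnorm

/-! ### Asymptotics of the connection formula -/

lemma tendsto_kernel_div_rpow {a b : ℕ → ℝ} {α β A B : ℝ} (hαβ : 0 < α + β + 1)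
    (ha : Tendsto (fun n : ℕ => a n / ((-1 : ℝ) ^ n * (n : ℝ) ^ α)) atTop (𝓝 A))
    (hb : Tendsto (fun n : ℕ => b n / ((-1 : ℝ) ^ n * (n : ℝ) ^ β)) atTop (𝓝 B)) :
    Tendsto (fun n : ℕ => (∑ m ∈ Finset.range n, a m * b m) / (n : ℝ) ^ (α + β + 1)) atTop
      (𝓝 (A * B / (α + β + 1))) := by
  refine tendsto_sum_div_rpow hαβ ((ha.mul hb).congr' ?_)
  filter_upwards [eventually_gt_atTop 0] with n hn
  have hn' : (0 : ℝ) < n := by exact_mod_cast hn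
  have hs : (-1 : ℝ) ^ n * (-1) ^ n = 1 := by rw [← mul_pow]; simp
  rw [div_mul_div_comm, mul_mul_mul_comm, hs, one_mul, Real.rpow_add hn']

lemma exists_tendsto_of_perturbed_cauchy {ι : Type*} [Fintype ι] [DecidableEq ι] {a b : ι → ℝ}
    {κ : ι → ι → ℕ → ℝ} {ε φ : ι → ℕ → ℝ} {u : ℕ → ι → ℝ}
    (ha : Function.Injective a) (hb : Function.Injective b) (hab : ∀ j i, a j + b i ≠ 0)
    (hκ : ∀ j i, Tendsto (κ j i) atTop (𝓝 (a j + b i)⁻¹))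
    (hε : ∀ j, Tendsto (ε j) atTop (𝓝 0)) (hφ : ∀ j, Tendsto (φ j) atTop (𝓝 1))
    (h : ∀ᶠ n in atTop, ∀ j, ∑ i, κ j i n * u n i + ε j n * u n j = φ j n) :
    ∃ u₀ : ι → ℝ, Tendsto u atTop (𝓝 u₀) ∧ ∀ j, ∑ i, (a j + b i)⁻¹ * u₀ i = 1 := by
  have hdet := cauchy_det_ne_zero_s2 ha hb hab
  set A₀ : Matrix ι ι ℝ := Matrix.of fun j i => (a j + b i)⁻¹ with hA₀
  set A : ℕ → Matrix ι ι ℝ := fun n =>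
    Matrix.of (fun j i => κ j i n) + Matrix.diagonal fun j => ε j n with hA
  have hAlim : Tendsto A atTop (𝓝 A₀) := by
    refine tendsto_pi_nhds.2 fun j => tendsto_pi_nhds.2 fun i => ?_
    by_cases hji : j = i
    · subst hji
      simpa [hA, hA₀] using (hκ j j).add (hε j)
    · simpa [hA, hA₀, Matrix.diagonal_apply_ne _ hji] using hκ j i
  refine ⟨A₀⁻¹.mulVec 1, tendsto_of_mulVec_eventuallyEq (b := fun n j => φ j n) hAlim
    (tendsto_pi_nhds.2 hφ) hdet ?_, fun j => ?_⟩
  · filter_upwards [h] with n hn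
    ext j
    rw [← hn j, hA, Matrix.add_mulVec, Pi.add_apply, Matrix.mulVec_diagonal]
    rfl
  · have h1 : A₀.mulVec (A₀⁻¹.mulVec 1) = 1 := by
      rw [Matrix.mulVec_mulVec, Matrix.mul_nonsing_inv _ (isUnit_iff_ne_zero.2 hdet),
        Matrix.one_mulVec]
    exact congrFun h1 j

/-- The limit of `V k / P k` when `V` solves the linear system given by the kernels of `P`. -/
lemma tendsto_ratio_of_connection {J : Finset ℕ} {M : ℕ → ℝ} (hM : ∀ i ∈ J, 0 < M i)
    {P V : ℕ → ℕ → ℝ} {γ : ℕ → ℝ} (hγ : ∀ n, 0 < γ n)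
    (hV : ∀ n k, V k n = γ n * P k n -
      ∑ i ∈ J, M i * V i n * ∑ m ∈ Finset.range n, P i m * P k m)
    (hnorm : ∀ n, γ n * (γ n + ∑ i ∈ J, M i * V i n * P i n) = 1)
    {f : ℕ → ℝ} (hf : StrictMono f) (hf0 : 0 < 2 * f 0 + 1)
    {C : ℕ → ℝ} (hC : ∀ k, C k ≠ 0)
    (hlim : ∀ k, Tendsto (fun n : ℕ => P k n / ((-1 : ℝ) ^ n * (n : ℝ) ^ f k)) atTop (𝓝 (C k)))
    (k : ℕ) :
    Tendsto (fun n => V k n / P k n) atTop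
      (𝓝 (∏ i ∈ J, (f k - f i) / (f k + f i + 1))) := by
  have hpos : ∀ i j, 0 < f i + f j + 1 := fun i j => by
    have := hf.monotone (Nat.zero_le i)
    have := hf.monotone (Nat.zero_le j)
    linarith
  set φ : ℕ → ℕ → ℝ := fun j n => P j n / ((-1 : ℝ) ^ n * (n : ℝ) ^ f j) / C j with hφ
  set κ : ℕ → ℕ → ℕ → ℝ := fun j i n =>
    (∑ m ∈ Finset.range n, P i m * P j m) / (n : ℝ) ^ (f i + f j + 1) / (C i * C j) with hκ
  set u : ℕ → J → ℝ := fun n i =>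
    M i * V i n * C i * (n : ℝ) ^ (f i + 1) * (-1) ^ n / γ n with hu
  have hφlim : ∀ j, Tendsto (φ j) atTop (𝓝 1) := fun j => by
    simpa [hC j] using (hlim j).div_const (C j)
  have hκlim : ∀ j i, Tendsto (κ j i) atTop (𝓝 (f j + (f i + 1))⁻¹) := fun j i => by
    have h := (tendsto_kernel_div_rpow (hpos i j) (hlim i) (hlim j)).div_const (C i * C j)
    convert h using 2
    have h1 := hC i
    have h2 := hC j
    have h3 := (hpos i j).ne'
    rw [show f j + (f i + 1) = f i + f j + 1 by ring]
    field_simp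
  have hsystem : ∀ n : ℕ, 0 < n → ∀ j, V j n / ((-1) ^ n * γ n * C j * (n : ℝ) ^ f j) =
      φ j n - ∑ i : J, κ j i n * u n i := by
    intro n hn j
    have hn' : (0 : ℝ) < n := by exact_mod_cast hn
    have hγn := (hγ n).ne'
    have hCj := hC j
    have hs : ((-1 : ℝ) ^ n) ^ 2 = 1 := by rw [← pow_mul, mul_comm, pow_mul]; simp
    have hs0 : (-1 : ℝ) ^ n ≠ 0 := by simp
    have hnj : (n : ℝ) ^ f j ≠ 0 := (Real.rpow_pos_of_pos hn' _).ne'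
    rw [hV n j, sub_div, ← Finset.sum_coe_sort J, Finset.sum_div]
    congr 1
    · simp only [hφ]
      field_simp
    · refine Finset.sum_congr rfl fun i _ => ?_
      have hCi := hC i
      have hni : (n : ℝ) ^ (f i + 1) ≠ 0 := (Real.rpow_pos_of_pos hn' _).ne'
      simp only [hκ, hu]
      rw [show f i + f j + 1 = (f i + 1) + f j by ring, Real.rpow_add hn']
      generalize (∑ m ∈ Finset.range n, P i m * P j m) = S
      field_simp
      rw [hs, mul_one]
  have hulim : ∃ u₀ : J → ℝ, Tendsto u atTop (𝓝 u₀) ∧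
      ∀ j : J, ∑ i : J, (f j + (f i + 1))⁻¹ * u₀ i = 1 := by
    refine exists_tendsto_of_perturbed_cauchy (a := fun j : J => f j) (b := fun i : J => f i + 1)
      (κ := fun j i => κ j i) (φ := fun j => φ j)
      (ε := fun j n => (M j * C j ^ 2 * (n : ℝ) ^ (2 * f j + 1))⁻¹)
      (hf.injective.comp Subtype.val_injective)
      (fun i j h => Subtype.ext (hf.injective (add_right_cancel h)))
      (fun j i => by simpa [add_assoc] using (hpos j i).ne')
      (fun j i => hκlim j i) (fun j => ?_) (fun j => hφlim j) ?_
    · refine Tendsto.inv_tendsto_atTop (Tendsto.const_mul_atTop ?_ ?_)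
      · have := hM j j.2
        have := hC j
        positivity
      · have := hpos j j
        exact (tendsto_rpow_atTop (by linarith)).comp tendsto_natCast_atTop_atTop
    · filter_upwards [eventually_gt_atTop 0] with n hn j
      have hn' : (0 : ℝ) < n := by exact_mod_cast hn
      have h := hsystem n hn j
      have hdiag : (M j * C j ^ 2 * (n : ℝ) ^ (2 * f j + 1))⁻¹ * u n j =
          V j n / ((-1) ^ n * γ n * C j * (n : ℝ) ^ f j) := by
        have hγn := (hγ n).ne'
        have hCj := hC j
        have hMj := (hM j j.2).ne'
        have hs : ((-1 : ℝ) ^ n) ^ 2 = 1 := by rw [← pow_mul, mul_comm, pow_mul]; simp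
        have hs0 : (-1 : ℝ) ^ n ≠ 0 := by simp
        have hnj : (n : ℝ) ^ f j ≠ 0 := (Real.rpow_pos_of_pos hn' _).ne'
        have hnj1 : (n : ℝ) ^ (f j + 1) ≠ 0 := (Real.rpow_pos_of_pos hn' _).ne'
        simp only [hu]
        rw [show 2 * f j + 1 = (f j + 1) + f j by ring, Real.rpow_add hn']
        field_simp
        rw [hs, mul_one]
      rw [hdiag, h]
      ring
  obtain ⟨u₀, hu₀, hsol⟩ := hulim
  have hγlim : Tendsto γ atTop (𝓝 1) := by
    have hsum : Tendsto (fun n : ℕ => 1 + ∑ i : J, u n i * φ i n * (n : ℝ)⁻¹) atTop (𝓝 1) := by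
      have h : Tendsto (fun n : ℕ => ∑ i : J, u n i * φ i n * (n : ℝ)⁻¹) atTop
          (𝓝 (∑ i : J, u₀ i * 1 * 0)) :=
        tendsto_finsetSum _ fun i _ => ((tendsto_pi_nhds.1 hu₀ i).mul (hφlim i)).mul
          tendsto_inv_atTop_nhds_zero_nat
      simpa using h.const_add 1
    have hsq : Tendsto (fun n => γ n ^ 2) atTop (𝓝 1) := by
      have hinv := hsum.inv₀ one_ne_zero
      rw [inv_one] at hinv
      refine hinv.congr' ?_
      filter_upwards [eventually_gt_atTop 0] with n hn
      have hn' : (0 : ℝ) < n := by exact_mod_cast hn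
      have hγn := (hγ n).ne'
      refine (eq_inv_of_mul_eq_one_left ?_).symm
      have hexpand : ∀ T : ℝ, γ n ^ 2 * (1 + T) = γ n * (γ n + γ n * T) := fun T => by ring
      refine (hexpand _).trans (Eq.trans ?_ (hnorm n))
      rw [← Finset.sum_coe_sort J, Finset.mul_sum]
      congr 2
      refine Finset.sum_congr rfl fun i _ => ?_
      have hCi := hC i
      have hni : (n : ℝ) ^ f i ≠ 0 := (Real.rpow_pos_of_pos hn' _).ne'
      have hs0 : (-1 : ℝ) ^ n ≠ 0 := by simp
      simp only [hu, hφ]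
      rw [Real.rpow_add_one hn'.ne']
      field_simp
    have h := hsq.sqrt
    rw [Real.sqrt_one] at h
    exact h.congr fun n => Real.sqrt_sq (hγ n).le
  have hfinal : Tendsto (fun n => γ n * (φ k n - ∑ i : J, κ k i n * u n i) / φ k n) atTop
      (𝓝 (1 * (1 - ∑ i : J, (f k + (f i + 1))⁻¹ * u₀ i) / 1)) :=
    (hγlim.mul ((hφlim k).sub (tendsto_finsetSum _ fun (i : J) _ =>
      (hκlim k i).mul (tendsto_pi_nhds.1 hu₀ i)))).div (hφlim k) one_ne_zero
  rw [div_one, one_mul, one_sub_cauchy_sum_eq_prod (a := fun j : J => f j)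
    (b := fun i : J => f i + 1) (hf.injective.comp Subtype.val_injective)
    (fun j i => by simpa [add_assoc] using (hpos j i).ne') hsol
    (fun i => by simpa [add_assoc] using (hpos k i).ne')] at hfinal
  simp only [← add_assoc] at hfinal
  rw [Finset.prod_coe_sort J fun i => (f k - f i) / (f k + f i + 1)] at hfinal
  refine hfinal.congr' ?_
  filter_upwards [eventually_gt_atTop 0] with n hn
  have hn' : (0 : ℝ) < n := by exact_mod_cast hn
  have hγn := (hγ n).ne'
  have hCk := hC k
  have hnk : (n : ℝ) ^ f k ≠ 0 := (Real.rpow_pos_of_pos hn' _).ne'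
  have hs0 : (-1 : ℝ) ^ n ≠ 0 := by simp
  rw [← hsystem n hn k]
  simp only [hφ]
  rcases eq_or_ne (P k n) 0 with h0 | h0
  · simp [h0]
  · field_simp

/-- **Corollary 1.** Under the hypotheses of Lemma 2, with `j_1 < … < j_s` exactly the
indices `i ∈ {0,…,r}` with `M_i > 0`,
`lim q_n^{(r+1)}(c)/p_n^{(r+1)}(c) = ∏_{i=1}^s (f(r+1)-f(j_i))/(f(r+1)+f(j_i)+1)`. -/
theorem ratio_derivative_r_plus_one
    (μ : Measure ℝ) [IsFiniteMeasure μ]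
    (hsupp : (measSupport μ).Infinite)
    (hint : ∀ p : Polynomial ℝ, Integrable (fun x => p.eval x) μ)
    (c : ℝ) (r : ℕ) (M : ℕ → ℝ) (hM : ∀ i ≤ r, 0 ≤ M i)
    (p : ℕ → Polynomial ℝ) (hp : IsOPS μ p)
    (q : ℕ → Polynomial ℝ) (hq : IsSobOPS μ c r M q)
    (f : ℕ → ℝ) (hf : StrictMono f) (hf0 : 0 < 2 * f 0 + 1)
    (C : ℕ → ℝ) (hC : ∀ k, C k ≠ 0)
    (hlim : ∀ k, Filter.Tendsto
      (fun n : ℕ => (Polynomial.derivative^[k] (p n)).eval c / ((-1 : ℝ) ^ n * (n : ℝ) ^ (f k)))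
      Filter.atTop (nhds (C k))) :
    Filter.Tendsto
      (fun n : ℕ =>
        (Polynomial.derivative^[r + 1] (q n)).eval c /
          (Polynomial.derivative^[r + 1] (p n)).eval c)
      Filter.atTop
      (nhds (∏ i ∈ (Finset.range (r + 1)).filter (fun i => 0 < M i),
        (f (r + 1) - f i) / (f (r + 1) + f i + 1))) := by
  choose γ hγ hconn hnorm using exists_sobolev_connection hint hM hp hq
  exact tendsto_ratio_of_connection
    (P := fun k n => (derivative^[k] (p n)).eval c) (V := fun k n => (derivative^[k] (q n)).eval c)
    (fun i hi => (Finset.mem_filter.1 hi).2) hγ hconn hnorm hf hf0 hC hlim (r + 1)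
end
end
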